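/- Let Δ ≥ 3, let 3 ≤ l ≤ n − Δ + 2, and let G ∈ 𝒫_{n,Δ}^l. Then Kf(G) ≤ Kf(P_{n,Δ}^3), with equality if and only if G is isomorphic to P_{n,Δ}^3. -/

import Mathlib

open scoped Classical

noncomputable section

namespace KfPaper

variable {V : Type*} {W : Type*}

/-- The energy of a potential `f` on graph `G`, viewing each edge as a unit resistor:
`(1/2) · ∑_{x,y adjacent} (f x - f y)²` (each edge counted twice, hence the `1/2`). -/
def energy [Fintype V] (G : SimpleGraph V) (f : V → ℝ) : ℝ :=
  (1 / 2) * ∑ x : V, ∑ y : V, (if G.Adj x y then (f x - f y) ^ 2 else 0)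

/-- The resistance distance (effective resistance) between `u` and `v`:
`r(u,v) = 1 / inf { energy f : f u = 1, f v = 0 }` and `r(u,u) = 0`. -/
def resistanceDistance [Fintype V] (G : SimpleGraph V) (u v : V) : ℝ :=
  if u = v then 0
  else 1 / sInf {e : ℝ | ∃ f : V → ℝ, f u = 1 ∧ f v = 0 ∧ energy G f = e}

/-- The Kirchhoff index: sum of resistance distances over unordered pairs of distinct
vertices (each ordered pair counted once via the factor `1/2`, diagonal terms vanish). -/
def kirchhoffIndex [Fintype V] (G : SimpleGraph V) : ℝ :=
  (1 / 2) * ∑ u : V, ∑ v : V, resistanceDistance G u v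

/-- `Kf_v(G) = ∑_{u ≠ v} r(v,u)` (the term `u = v` contributes `0`). -/
def kirchhoffAt [Fintype V] (G : SimpleGraph V) (v : V) : ℝ :=
  ∑ u : V, resistanceDistance G v u

/-- The Wiener index: sum of graph distances over unordered pairs of distinct vertices. -/
def wienerIndex [Fintype V] (G : SimpleGraph V) : ℝ :=
  (1 / 2) * ∑ u : V, ∑ v : V, (G.dist u v : ℝ)

/-- `W_v(G) = ∑_u d(v,u)`. -/
def wienerAt [Fintype V] (G : SimpleGraph V) (v : V) : ℝ :=
  ∑ u : V, (G.dist v u : ℝ)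

/-- The degree of a vertex. -/
def degree' (G : SimpleGraph V) (v : V) : ℕ := Nat.card (G.neighborSet v)

/-- `G` has maximum degree `Δ`. -/
def HasMaxDegree (G : SimpleGraph V) (Δ : ℕ) : Prop :=
  (∀ v, degree' G v ≤ Δ) ∧ ∃ v, degree' G v = Δ

/-- A unicyclic graph: a connected graph containing exactly one cycle, equivalently a
connected graph with as many edges as vertices. -/
def IsUnicyclic [Fintype V] (G : SimpleGraph V) : Prop :=
  G.Connected ∧ Nat.card G.edgeSet = Fintype.card V

/-- `P_{n,Δ}^3`: the unicyclic graph on `Fin n` with a triangle on `0,1,2`, with `Δ−3`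
pendant vertices `3,…,Δ−1` attached to the triangle vertex `2`, and one end-vertex of the
path `Δ, Δ+1, …, n−1` (on `n−Δ` vertices) attached to `2` (so `2` has degree `Δ`). -/
def PnD3 (n Δ : ℕ) : SimpleGraph (Fin n) :=
  SimpleGraph.fromRel (fun i j =>
    (i.val = 0 ∧ j.val = 1) ∨ (i.val = 0 ∧ j.val = 2) ∨ (i.val = 1 ∧ j.val = 2) ∨
    (i.val = 2 ∧ 3 ≤ j.val ∧ j.val ≤ Δ) ∨
    (Δ ≤ i.val ∧ j.val = i.val + 1))

/-- The graph on `Fin n` consisting of the cycle `0,…,l−1`, a path `l−1, l, …, t−1`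
attached to the cycle at the vertex `l−1` (so that `0,…,t−1` induce a copy of `P_t^l`),
together with `n−t` pendant vertices `t,…,n−1` all attached to the vertex `p`. -/
def PtLpend (n l t p : ℕ) : SimpleGraph (Fin n) :=
  SimpleGraph.fromRel (fun i j =>
    (i.val + 1 = j.val ∧ j.val ≤ t - 1) ∨
    (i.val = 0 ∧ j.val = l - 1) ∨
    (i.val = p ∧ t ≤ j.val))

/-- Membership in the family `𝒫_{n,Δ}^l`: `G` is (isomorphic to) a graph obtained from
`P_t^l` for some `t ≤ n−1` by attaching `n−t` pendant edges to one vertex `p` in such a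
way that `p` gets degree `Δ`, which is the maximum degree of the resulting graph. -/
def MemPset (n l Δ : ℕ) [Fintype V] (G : SimpleGraph V) : Prop :=
  ∃ (t p : ℕ) (hp : p < n), l ≤ t ∧ t ≤ n - 1 ∧ p < t ∧
    degree' (PtLpend n l t p) ⟨p, hp⟩ = Δ ∧
    HasMaxDegree (PtLpend n l t p) Δ ∧
    Nonempty (G ≃g PtLpend n l t p)

/-! ### Resistance distances from a Laplacian certificate -/

lemma energy_nonneg [Fintype V] (G : SimpleGraph V) (f : V → ℝ) : 0 ≤ energy G f := by
  unfold energy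
  refine mul_nonneg (by norm_num) (Finset.sum_nonneg fun x _ => Finset.sum_nonneg fun y _ => ?_)
  split_ifs <;> positivity

lemma sum_adj_mul_sub [Fintype V] (G : SimpleGraph V) (f h : V → ℝ) :
    ∑ x, ∑ y, (if G.Adj x y then (f x - f y) * (h x - h y) else 0)
      = 2 * ∑ x, f x * ∑ y, (if G.Adj x y then h x - h y else 0) := by
  have hswap : ∑ x, ∑ y, (if G.Adj x y then f y * (h y - h x) else 0)
      = ∑ x, ∑ y, (if G.Adj x y then f x * (h x - h y) else 0) := by
    rw [Finset.sum_comm]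
    simp only [G.adj_comm]
  have hsplit : ∀ x y, (if G.Adj x y then (f x - f y) * (h x - h y) else 0)
      = (if G.Adj x y then f x * (h x - h y) else 0)
        + (if G.Adj x y then f y * (h y - h x) else 0) := by
    intro x y
    split_ifs <;> ring
  simp only [hsplit, Finset.sum_add_distrib, hswap, Finset.mul_sum, mul_ite, mul_zero]
  rw [← Finset.sum_add_distrib]
  refine Finset.sum_congr rfl fun x _ => ?_
  rw [← Finset.sum_add_distrib]
  refine Finset.sum_congr rfl fun y _ => ?_
  split_ifs <;> ring

lemma energy_sub_mul [Fintype V] (G : SimpleGraph V) (f h : V → ℝ) (c : ℝ) :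
    energy G (fun x => f x - c * h x) = energy G f
      - 2 * c * ∑ x, f x * ∑ y, (if G.Adj x y then h x - h y else 0)
      + c ^ 2 * ∑ x, h x * ∑ y, (if G.Adj x y then h x - h y else 0) := by
  have e1 := sum_adj_mul_sub G f h
  have e2 := sum_adj_mul_sub G h h
  have hsplit : ∀ x y, (if G.Adj x y then (f x - c * h x - (f y - c * h y)) ^ 2 else 0)
      = (if G.Adj x y then (f x - f y) ^ 2 else 0)
        - 2 * c * (if G.Adj x y then (f x - f y) * (h x - h y) else 0)
        + c ^ 2 * (if G.Adj x y then (h x - h y) * (h x - h y) else 0) := by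
    intro x y
    split_ifs <;> ring
  unfold energy
  simp only [hsplit, Finset.sum_add_distrib, Finset.sum_sub_distrib, ← Finset.mul_sum, e1, e2]
  ring

/-- A symmetric function vanishing on the diagonal whose Laplacian in the first variable is
`-2` times the identity, up to a function of that variable alone, is the resistance distance. -/
lemma resistanceDistance_eq_of_laplacian [Fintype V] (G : SimpleGraph V) (R : V → V → ℝ)
    (c : V → ℝ) (hsymm : ∀ u v, R u v = R v u) (hself : ∀ v, R v v = 0)
    (hlap : ∀ x v, ∑ y, (if G.Adj x y then R x v - R y v else 0)
      = c x - if x = v then 2 else 0) (u v : V) :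
    resistanceDistance G u v = R u v := by
  unfold resistanceDistance
  split_ifs with huv
  · rw [huv, hself]
  set h : V → ℝ := fun x => (R x v - R x u) / 2 with hh
  have hLh : ∀ x, ∑ y, (if G.Adj x y then h x - h y else 0)
      = (if x = u then 1 else 0) - (if x = v then 1 else 0) := by
    intro x
    have hsplit : ∀ y, (if G.Adj x y then h x - h y else 0)
        = ((if G.Adj x y then R x v - R y v else 0)
          - (if G.Adj x y then R x u - R y u else 0)) / 2 := by
      intro y
      simp only [hh]
      split_ifs <;> ring
    simp only [hsplit, ← Finset.sum_div, Finset.sum_sub_distrib, hlap]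
    split_ifs <;> ring
  have hpair : ∀ f : V → ℝ, ∑ x, f x * ∑ y, (if G.Adj x y then h x - h y else 0)
      = f u - f v := by
    intro f
    simp [hLh, mul_sub, Finset.sum_sub_distrib]
  have hE : ∀ (f : V → ℝ) (a : ℝ), f u = 1 → f v = 0 →
      energy G (fun x => f x - a * h x) = energy G f - 2 * a + a ^ 2 * R u v := by
    intro f a hfu hfv
    rw [energy_sub_mul, hpair, hpair, hfu, hfv]
    simp only [hh, hself, hsymm v u]
    ring
  have hEh : energy G h = R u v := by
    have := energy_sub_mul G (fun _ => 0) h (-1)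
    rw [hpair, hpair] at this
    simp only [hh, hself, hsymm v u] at this ⊢
    simp only [zero_sub, neg_mul, one_mul, neg_neg] at this
    rw [this]
    simp only [energy, sub_self]
    norm_num
    ring
  have hpos : 0 < R u v := by
    refine lt_of_le_of_ne (hEh ▸ energy_nonneg G h) fun h0 => ?_
    obtain ⟨f, hfu, hfv⟩ : ∃ f : V → ℝ, f u = 1 ∧ f v = 0 :=
      ⟨fun x => if x = u then 1 else 0, by simp, by simp [Ne.symm huv]⟩
    have h1 := hE f (energy G f + 1) hfu hfv
    have h2 := energy_nonneg G (fun x => f x - (energy G f + 1) * h x)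
    have h3 := energy_nonneg G f
    rw [← h0] at h1
    linarith
  have hleast : IsLeast {e : ℝ | ∃ f : V → ℝ, f u = 1 ∧ f v = 0 ∧ energy G f = e}
      (1 / R u v) := by
    constructor
    · refine ⟨fun x => 0 - (-(1 / R u v)) * (h x - h v), ?_, ?_, ?_⟩
      · simp only [hh, hself, hsymm v u]
        field_simp
        ring
      · simp
      · have hconst : energy G (fun x => 0 - (-(1 / R u v)) * (h x - h v))
            = (1 / R u v) ^ 2 * energy G h := by
          unfold energy
          simp only [Finset.mul_sum]
          refine Finset.sum_congr rfl fun x _ => Finset.sum_congr rfl fun y _ => ?_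
          split_ifs <;> ring
        rw [hconst, hEh]
        field_simp
    · rintro e ⟨f, hfu, hfv, rfl⟩
      have h1 := hE f (1 / R u v) hfu hfv
      have h2 := energy_nonneg G (fun x => f x - 1 / R u v * h x)
      have h3 : (1 / R u v) ^ 2 * R u v = 1 / R u v := by field_simp
      linarith
  rw [hleast.csInf_eq]
  simp

lemma energy_comp_iso [Fintype V] [Fintype W] {G : SimpleGraph V} {H : SimpleGraph W}
    (φ : G ≃g H) (f : W → ℝ) : energy G (fun x => f (φ x)) = energy H f := by
  unfold energy
  congr 1
  rw [← φ.toEquiv.sum_comp]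
  refine Finset.sum_congr rfl fun x _ => ?_
  rw [← φ.toEquiv.sum_comp]
  refine Finset.sum_congr rfl fun y _ => ?_
  have : H.Adj (φ.toEquiv x) (φ.toEquiv y) ↔ G.Adj x y := φ.map_rel_iff
  simp only [this]
  rfl

lemma kirchhoffIndex_eq_of_iso [Fintype V] [Fintype W] {G : SimpleGraph V} {H : SimpleGraph W}
    (φ : G ≃g H) : kirchhoffIndex G = kirchhoffIndex H := by
  have hr : ∀ u v, resistanceDistance H (φ u) (φ v) = resistanceDistance G u v := by
    intro u v
    have hset : {e : ℝ | ∃ f : W → ℝ, f (φ u) = 1 ∧ f (φ v) = 0 ∧ energy H f = e}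
        = {e : ℝ | ∃ f : V → ℝ, f u = 1 ∧ f v = 0 ∧ energy G f = e} := by
      ext e
      constructor
      · rintro ⟨f, h1, h0, rfl⟩
        exact ⟨fun x => f (φ x), h1, h0, energy_comp_iso φ f⟩
      · rintro ⟨f, h1, h0, rfl⟩
        exact ⟨fun y => f (φ.symm y), by simpa using h1, by simpa using h0,
          energy_comp_iso φ.symm f⟩
    unfold resistanceDistance
    simp only [hset, φ.injective.eq_iff]
  unfold kirchhoffIndex
  congr 1
  rw [← φ.toEquiv.sum_comp]
  refine Finset.sum_congr rfl fun x _ => ?_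
  rw [← φ.toEquiv.sum_comp]
  exact Finset.sum_congr rfl fun y _ => (hr x y).symm

/-! ### Resistance distances in a cycle with a tail and pendant vertices -/

/-- The adjacency relation of `PtLpend`, on all natural numbers. -/
def Link (l t p i j : ℕ) : Prop :=
  i ≠ j ∧ (((i + 1 = j ∧ j ≤ t - 1) ∨ (i = 0 ∧ j = l - 1) ∨ (i = p ∧ t ≤ j)) ∨
    ((j + 1 = i ∧ i ≤ t - 1) ∨ (j = 0 ∧ i = l - 1) ∨ (j = p ∧ t ≤ i)))

lemma PtLpend_adj {n l t p : ℕ} (x y : Fin n) :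
    (PtLpend n l t p).Adj x y ↔ Link l t p x y := by
  simp only [PtLpend, SimpleGraph.fromRel_adj, Link, Fin.ext_iff, ne_eq]

/-- The vertex to which a vertex outside the cycle is attached. -/
def parent (t p n : ℕ) : ℕ := if n < t then n - 1 else p

lemma parent_lt {l t p n : ℕ} (hl : 3 ≤ l) (hp : p < t) (hn : l ≤ n) : parent t p n < n := by
  unfold parent; split_ifs <;> omega

lemma link_comm {l t p i j : ℕ} : Link l t p i j ↔ Link l t p j i := by
  unfold Link; tauto

lemma link_attach {l t p n x : ℕ} (hl : 3 ≤ l) (hlt : l ≤ t) (hp : p < t) (hn : l ≤ n)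
    (hx : x < n) : Link l t p x n ↔ x = parent t p n := by
  unfold parent Link
  split_ifs <;> omega

lemma link_cycle {l t p i j : ℕ} (hl : 3 ≤ l) (hlt : l ≤ t) (hi : i < l) (hj : j < l) :
    Link l t p i j ↔ i + 1 = j ∨ j + 1 = i ∨ (i = 0 ∧ j = l - 1) ∨ (j = 0 ∧ i = l - 1) := by
  unfold Link
  omega

/-- The resistance distance in the cycle `0, …, l - 1`. -/
def cycleRes (l i j : ℕ) : ℝ := |(i : ℝ) - j| - ((i : ℝ) - j) ^ 2 / l

lemma cycleRes_self (l i : ℕ) : cycleRes l i i = 0 := by simp [cycleRes]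

lemma cycleRes_comm (l i j : ℕ) : cycleRes l i j = cycleRes l j i := by
  unfold cycleRes; rw [abs_sub_comm]; ring

lemma cycleRes_of_le {l i j : ℕ} (h : i ≤ j) :
    cycleRes l i j = (j - i) - ((i : ℝ) - j) ^ 2 / l := by
  unfold cycleRes
  rw [abs_of_nonpos (by have : (i : ℝ) ≤ j := by exact_mod_cast h
                        linarith)]
  ring

lemma cycleRes_of_ge {l i j : ℕ} (h : j ≤ i) :
    cycleRes l i j = (i - j) - ((i : ℝ) - j) ^ 2 / l := by
  rw [cycleRes_comm, cycleRes_of_le h]; ring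

/-- The resistance distance in `P_t^l` on `0, …, t - 1`. -/
def lollipopRes (l i j : ℕ) : ℝ :=
  cycleRes l (min i (l - 1)) (min j (l - 1)) +
    |((i - (l - 1) : ℕ) : ℝ) - ((j - (l - 1) : ℕ) : ℝ)|

/-- The resistance distance in `PtLpend`. -/
def pendantRes (l t p i j : ℕ) : ℝ :=
  if i = j then 0 else
    lollipopRes l (if i < t then i else p) (if j < t then j else p)
      + (if i < t then 0 else 1) + (if j < t then 0 else 1)

lemma lollipopRes_self (l i : ℕ) : lollipopRes l i i = 0 := by
  simp [lollipopRes, cycleRes_self]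

lemma lollipopRes_comm (l i j : ℕ) : lollipopRes l i j = lollipopRes l j i := by
  unfold lollipopRes; rw [cycleRes_comm, abs_sub_comm]

lemma pendantRes_self (l t p i : ℕ) : pendantRes l t p i i = 0 := by simp [pendantRes]

lemma pendantRes_comm (l t p i j : ℕ) : pendantRes l t p i j = pendantRes l t p j i := by
  unfold pendantRes
  rw [lollipopRes_comm]
  by_cases h : i = j
  · simp [h]
  · rw [if_neg h, if_neg (Ne.symm h)]; ring

lemma pendantRes_of_lt {l t p i j : ℕ} (hi : i < t) (hj : j < t) :
    pendantRes l t p i j = lollipopRes l i j := by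
  unfold pendantRes
  split_ifs with h
  · rw [h, lollipopRes_self]
  · simp

lemma pendantRes_cycle {l t p i j : ℕ} (hlt : l ≤ t) (hi : i < l) (hj : j < l) :
    pendantRes l t p i j = cycleRes l i j := by
  rw [pendantRes_of_lt (by omega) (by omega), lollipopRes, min_eq_left (by omega),
    min_eq_left (by omega), Nat.sub_eq_zero_of_le (by omega), Nat.sub_eq_zero_of_le (by omega)]
  simp

lemma pendantRes_attach {l t p n x : ℕ} (hl : 3 ≤ l) (hp : p < t) (hn : l ≤ n)
    (hx : x < n) : pendantRes l t p n x = pendantRes l t p (parent t p n) x + 1 := by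
  unfold parent
  split_ifs with hnt
  · rw [pendantRes_of_lt hnt (by omega), pendantRes_of_lt (by omega) (by omega)]
    unfold lollipopRes
    have hle : ((x - (l - 1) : ℕ) : ℝ) ≤ ((n - 1 - (l - 1) : ℕ) : ℝ) := by
      exact_mod_cast (by omega)
    have hsucc : ((n - (l - 1) : ℕ) : ℝ) = ((n - 1 - (l - 1) : ℕ) : ℝ) + 1 := by
      exact_mod_cast (by omega)
    rw [min_eq_right (by omega : l - 1 ≤ n), min_eq_right (by omega : l - 1 ≤ n - 1), hsucc,
      abs_of_nonneg (by linarith), abs_of_nonneg (by linarith)]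
    ring
  · unfold pendantRes
    rw [if_neg (by omega), if_neg hnt, if_neg hnt, if_pos hp, if_pos hp]
    by_cases hxt : x < t
    · rw [if_pos hxt, if_pos hxt]
      split_ifs with h
      · rw [h, lollipopRes_self]; ring
      · ring
    · rw [if_neg hxt, if_neg hxt, if_neg (by omega), lollipopRes_self]
      ring

lemma cycleRes_laplacian {l t p x v : ℕ} (hl : 3 ≤ l) (hlt : l ≤ t) (hx : x < l) (hv : v < l) :
    ∑ y ∈ Finset.range l, (if Link l t p x y then cycleRes l x v - cycleRes l y v else 0)
      = 2 / l - if x = v then 2 else 0 := by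
  have hl0 : (l : ℝ) ≠ 0 := by positivity
  have hcast : ((l - 1 : ℕ) : ℝ) = l - 1 := by push_cast [Nat.cast_sub (by omega : 1 ≤ l)]; ring
  rw [← Finset.sum_filter]
  have key : ∀ a b : ℕ, a ≠ b → a < l → b < l → (∀ y < l, Link l t p x y ↔ y = a ∨ y = b) →
      ∑ y ∈ (Finset.range l).filter (fun y => Link l t p x y),
        (cycleRes l x v - cycleRes l y v)
      = (cycleRes l x v - cycleRes l a v) + (cycleRes l x v - cycleRes l b v) := by
    intro a b hab ha hb h
    have : (Finset.range l).filter (fun y => Link l t p x y) = {a, b} := by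
      ext y
      simp only [Finset.mem_filter, Finset.mem_range, Finset.mem_insert, Finset.mem_singleton]
      constructor
      · rintro ⟨hy, hL⟩; exact (h y hy).1 hL
      · intro hy
        have hyl : y < l := by omega
        exact ⟨hyl, (h y hyl).2 hy⟩
    rw [this, Finset.sum_pair hab]
  rcases Nat.eq_zero_or_pos x with rfl | hx0
  · rw [key 1 (l - 1) (by omega) (by omega) (by omega)
      (fun y hy => by rw [link_cycle hl hlt hx hy]; omega)]
    rw [cycleRes_of_le (Nat.zero_le v), cycleRes_of_ge (by omega : v ≤ l - 1), hcast]
    rcases Nat.eq_zero_or_pos v with rfl | hv0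
    · rw [cycleRes_of_ge (by omega)]
      simp only [if_true]; push_cast; field_simp; ring
    · rw [cycleRes_of_le (by omega), if_neg (by omega)]
      push_cast; field_simp; ring
  obtain ⟨x, rfl⟩ : ∃ x', x = x' + 1 := ⟨x - 1, by omega⟩
  rcases Nat.lt_or_ge (x + 2) l with hxl | hxl
  · rw [key x (x + 2) (by omega) (by omega) (by omega)
      (fun y hy => by rw [link_cycle hl hlt hx hy]; omega)]
    rcases lt_trichotomy (x + 1) v with h | h | h
    · rw [cycleRes_of_le (by omega), cycleRes_of_le (by omega), cycleRes_of_le (by omega),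
        if_neg (by omega)]
      push_cast; field_simp; ring
    · subst h
      rw [cycleRes_of_le (by omega), cycleRes_of_le (by omega), cycleRes_of_ge (by omega)]
      simp only [if_true]; push_cast; field_simp; ring
    · rw [cycleRes_of_ge (by omega), cycleRes_of_ge (by omega), cycleRes_of_ge (by omega),
        if_neg (by omega)]
      push_cast; field_simp; ring
  · obtain rfl : l = x + 2 := by omega
    rw [key x 0 (by omega) (by omega) (by omega)
      (fun y hy => by rw [link_cycle hl hlt hx hy]; omega)]
    rw [cycleRes_of_le (Nat.zero_le v), cycleRes_of_ge (by omega : v ≤ x + 1)]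
    rcases Nat.lt_or_ge x v with h | h
    · obtain rfl : v = x + 1 := by omega
      rw [cycleRes_of_le (by omega)]
      push_cast at hl0 ⊢
      simp only [if_true]; field_simp; ring
    · rw [cycleRes_of_ge (by omega), if_neg (by omega)]
      push_cast at hl0 ⊢
      field_simp; ring

lemma pendantRes_laplacian {l t p n : ℕ} (hl : 3 ≤ l) (hlt : l ≤ t) (hp : p < t) (hn : l ≤ n) :
    ∃ c : ℕ → ℝ, ∀ x < n, ∀ v < n, ∑ y ∈ Finset.range n,
      (if Link l t p x y then pendantRes l t p x v - pendantRes l t p y v else 0)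
        = c x - if x = v then 2 else 0 := by
  induction n, hn using Nat.le_induction with
  | base =>
    refine ⟨fun _ => 2 / l, fun x hx v hv => ?_⟩
    rw [← cycleRes_laplacian hl hlt hx hv (p := p)]
    refine Finset.sum_congr rfl fun y hy => ?_
    rw [pendantRes_cycle hlt hx hv, pendantRes_cycle hlt (Finset.mem_range.1 hy) hv]
  | succ n hn ih =>
    obtain ⟨c, hc⟩ := ih
    have hpar := parent_lt hl hp hn
    have hnew : ∀ v < n + 1, pendantRes l t p n v - pendantRes l t p (parent t p n) v
        = 1 - if n = v then 2 else 0 := by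
      intro v hv
      rcases Nat.lt_succ_iff_lt_or_eq.1 hv with h | rfl
      · rw [pendantRes_attach hl hp hn h, if_neg (by omega)]; ring
      · rw [pendantRes_comm l t p (parent t p v) v, pendantRes_attach hl hp hn hpar,
          pendantRes_self, pendantRes_self]
        simp only [if_true]; ring
    refine ⟨fun x => if x = n then 1 else if x = parent t p n then c x - 1 else c x,
      fun x hx v hv => ?_⟩
    rcases Nat.lt_succ_iff_lt_or_eq.1 hx with hxn | rfl
    · have hold : ∑ y ∈ Finset.range n,
          (if Link l t p x y then pendantRes l t p x v - pendantRes l t p y v else 0)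
            = c x - (if x = (if v = n then parent t p n else v) then 2 else 0) := by
        rcases Nat.lt_succ_iff_lt_or_eq.1 hv with h | rfl
        · rw [hc x hxn v h, if_neg (by omega : ¬ v = n)]
        · rw [if_pos rfl, ← hc x hxn _ hpar]
          refine Finset.sum_congr rfl fun y hy => ?_
          rw [pendantRes_comm l t p x v, pendantRes_comm l t p y v,
            pendantRes_attach hl hp hn hxn, pendantRes_attach hl hp hn (Finset.mem_range.1 hy),
            pendantRes_comm l t p x, pendantRes_comm l t p y]
          simp
      rw [Finset.sum_range_succ, hold]
      simp only [link_attach hl hlt hp hn hxn]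
      rw [if_neg (by omega : ¬ x = n)]
      by_cases hxp : x = parent t p n
      · have := hnew v hv
        rw [← hxp] at this ⊢
        simp only [if_true]
        rw [← neg_sub (pendantRes l t p n v), this]
        by_cases hvn : v = n
        · subst hvn
          simp only [if_true]
          rw [if_neg (by omega)]
          ring
        · rw [if_neg hvn, if_neg (Ne.symm hvn)]
          ring
      · rw [if_neg hxp, if_neg hxp]
        by_cases hvn : v = n
        · rw [if_pos hvn, if_neg hxp, if_neg (by omega)]; ring
        · rw [if_neg hvn]; ring
    · rw [Finset.sum_range_succ, sub_self, ite_self, add_zero]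
      beta_reduce
      rw [if_pos (rfl : x = x), ← hnew v hv,
        Finset.sum_eq_single (parent t p x)]
      · rw [if_pos (link_comm.1 ((link_attach hl hlt hp hn hpar).2 rfl))]
      · intro y hy hne
        rw [if_neg]
        rw [link_comm, link_attach hl hlt hp hn (Finset.mem_range.1 hy)]
        exact hne
      · intro h
        exact absurd (Finset.mem_range.2 hpar) h

lemma resistanceDistance_PtLpend {l t p n : ℕ} (hl : 3 ≤ l) (hlt : l ≤ t) (hp : p < t)
    (hn : l ≤ n) (u v : Fin n) :
    resistanceDistance (PtLpend n l t p) u v = pendantRes l t p u v := by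
  obtain ⟨c, hc⟩ := pendantRes_laplacian hl hlt hp hn
  refine resistanceDistance_eq_of_laplacian _ (fun u v : Fin n => pendantRes l t p u v)
    (fun x : Fin n => c x) (fun _ _ => pendantRes_comm ..) (fun _ => pendantRes_self ..) ?_ u v
  intro x v
  have := hc x x.2 v v.2
  rw [← Fin.sum_univ_eq_sum_range (fun y => if Link l t p x y then
    pendantRes l t p x v - pendantRes l t p y v else 0)] at this
  simp only [PtLpend_adj, this, Fin.ext_iff]

/-! ### The Kirchhoff index of `PtLpend` -/

/-- The sum of the resistance distances from `i` to the vertices below `n`. -/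
def resSum (l t p n i : ℕ) : ℝ := ∑ j ∈ Finset.range n, pendantRes l t p i j

/-- The Kirchhoff index of the part of `PtLpend` on the vertices below `n`. -/
def resTotal (l t p n : ℕ) : ℝ := (1 / 2) * ∑ i ∈ Finset.range n, resSum l t p n i

lemma kirchhoffIndex_PtLpend {l t p n : ℕ} (hl : 3 ≤ l) (hlt : l ≤ t) (hp : p < t)
    (hn : l ≤ n) : kirchhoffIndex (PtLpend n l t p) = resTotal l t p n := by
  unfold kirchhoffIndex resTotal resSum
  simp only [resistanceDistance_PtLpend hl hlt hp hn]
  rw [← Fin.sum_univ_eq_sum_range (fun i => ∑ j ∈ Finset.range n, pendantRes l t p i j)]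
  congr 1
  refine Finset.sum_congr rfl fun i _ => ?_
  rw [← Fin.sum_univ_eq_sum_range (fun j => pendantRes l t p i j)]

lemma resTotal_succ {l t p n : ℕ} (hl : 3 ≤ l) (hp : p < t) (hn : l ≤ n) :
    resTotal l t p (n + 1) = resTotal l t p n + resSum l t p n (parent t p n) + n := by
  have h1 : resSum l t p n n = resSum l t p n (parent t p n) + n := by
    unfold resSum
    rw [Finset.sum_congr rfl fun j hj => pendantRes_attach hl hp hn (Finset.mem_range.1 hj),
      Finset.sum_add_distrib]
    simp
  have h2 : ∀ i, resSum l t p (n + 1) i = resSum l t p n i + pendantRes l t p n i := by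
    intro i
    unfold resSum
    rw [Finset.sum_range_succ, pendantRes_comm l t p n]
  have h3 : ∑ i ∈ Finset.range n, pendantRes l t p n i = resSum l t p n n := rfl
  unfold resTotal
  simp only [h2]
  rw [Finset.sum_range_succ, Finset.sum_add_distrib, h3, pendantRes_self, h1]
  ring

lemma sum_abs_sub (x L : ℕ) (h : x ≤ L) :
    ∑ i ∈ Finset.range L, |(x : ℝ) - i|
      = (x : ℝ) * (x + 1) / 2 + ((L : ℝ) - x - 1) * (L - x) / 2 := by
  induction L, h using Nat.le_induction with
  | base =>
    have : ∀ m ≤ x, ∑ i ∈ Finset.range m, |(x : ℝ) - i| = m * x - (m : ℝ) * (m - 1) / 2 := by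
      intro m
      induction m with
      | zero => simp
      | succ m ih =>
        intro hm
        have hmx : (m : ℝ) + 1 ≤ x := by exact_mod_cast hm
        rw [Finset.sum_range_succ, ih (by omega), abs_of_nonneg (by linarith)]
        push_cast
        ring
    rw [this x le_rfl]
    ring
  | succ L hL ih =>
    have hLx : (x : ℝ) ≤ L := by exact_mod_cast hL
    rw [Finset.sum_range_succ, ih, abs_of_nonpos (by linarith)]
    push_cast
    ring

lemma sum_sq_sub (x L : ℕ) :
    ∑ i ∈ Finset.range L, ((x : ℝ) - i) ^ 2
      = L * (x : ℝ) ^ 2 - x * (L * (L - 1)) + ((L : ℝ) - 1) * L * (2 * L - 1) / 6 := by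
  induction L with
  | zero => simp
  | succ L ih =>
    rw [Finset.sum_range_succ, ih]
    push_cast
    ring

lemma sum_cycleRes {l x : ℕ} (hx : x < l) :
    ∑ j ∈ Finset.range l, cycleRes l x j = ((l : ℝ) ^ 2 - 1) / 6 := by
  have hl0 : (l : ℝ) ≠ 0 := by
    have : 0 < l := by omega
    positivity
  unfold cycleRes
  rw [Finset.sum_sub_distrib, ← Finset.sum_div, sum_abs_sub x l hx.le, sum_sq_sub]
  field_simp
  ring

/-- The sum of the resistance distances from a vertex of a cycle of length `l` with a tail of
length `s`, where `h` is the height of the vertex on the tail and `κ` is the resistance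
distance between its projection to the cycle and the foot of the tail. -/
def tailSum (l s h κ : ℝ) : ℝ :=
  (l ^ 2 - 1) / 6 + l * h + s * κ + h * (h - 1) / 2 + (s - h) * (s - h + 1) / 2

lemma resSum_tail {l t p s v : ℕ} (hl : 3 ≤ l) (hs : l + s ≤ t) (hv : v < l + s) :
    resSum l t p (l + s) v
      = tailSum l s (v - (l - 1) : ℕ) (cycleRes l (min v (l - 1)) (l - 1)) := by
  unfold resSum
  rw [Finset.sum_range_add]
  have hcyc : ∀ j ∈ Finset.range l, pendantRes l t p v j
      = cycleRes l (min v (l - 1)) j + ((v - (l - 1) : ℕ) : ℝ) := by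
    intro j hj
    have hj := Finset.mem_range.1 hj
    rw [pendantRes_of_lt (by omega) (by omega), lollipopRes,
      min_eq_left (by omega : j ≤ l - 1), Nat.sub_eq_zero_of_le (by omega : j ≤ l - 1)]
    simp
  have htail : ∀ i ∈ Finset.range s, pendantRes l t p v (l + i)
      = cycleRes l (min v (l - 1)) (l - 1) + |((v - (l - 1) : ℕ) : ℝ) - ((i + 1 : ℕ) : ℝ)| := by
    intro i hi
    have hi := Finset.mem_range.1 hi
    rw [pendantRes_of_lt (by omega) (by omega), lollipopRes,
      min_eq_right (by omega : l - 1 ≤ l + i), show l + i - (l - 1) = i + 1 by omega]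
  rw [Finset.sum_congr rfl hcyc, Finset.sum_congr rfl htail, Finset.sum_add_distrib,
    Finset.sum_add_distrib, sum_cycleRes (by omega)]
  have habs := sum_abs_sub (v - (l - 1)) (s + 1) (by omega)
  rw [Finset.sum_range_succ'] at habs
  rw [Nat.cast_zero, sub_zero, abs_of_nonneg (Nat.cast_nonneg _)] at habs
  rw [eq_sub_of_add_eq habs]
  simp only [Finset.sum_const, Finset.card_range, nsmul_eq_mul]
  unfold tailSum
  push_cast
  ring

/-- The Kirchhoff index of a cycle of length `l` with a tail of length `s`. -/
def lollipopKf (l s : ℝ) : ℝ :=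
  (l ^ 3 - l) / 12 + (s ^ 3 - s) / 6 + l * s * (s + 1) / 2 + s * (l ^ 2 - 1) / 6

lemma resTotal_tail {l t p s : ℕ} (hl : 3 ≤ l) (hp : p < t) (hs : l + s ≤ t) :
    resTotal l t p (l + s) = lollipopKf l s := by
  induction s with
  | zero =>
    have h : ∀ i ∈ Finset.range l, resSum l t p l i = ((l : ℝ) ^ 2 - 1) / 6 := by
      intro i hi
      have hi := Finset.mem_range.1 hi
      rw [← sum_cycleRes hi]
      exact Finset.sum_congr rfl fun j hj =>
        pendantRes_cycle (by omega) hi (Finset.mem_range.1 hj)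
    unfold resTotal lollipopKf
    rw [add_zero, Finset.sum_congr rfl h]
    simp only [Finset.sum_const, Finset.card_range, nsmul_eq_mul]
    push_cast
    ring
  | succ s ih =>
    rw [← add_assoc, resTotal_succ hl hp (by omega), ih (by omega), parent,
      if_pos (by omega), resSum_tail hl (by omega) (by omega),
      min_eq_right (by omega), cycleRes_self, show l + s - 1 - (l - 1) = s by omega]
    unfold tailSum lollipopKf
    push_cast
    ring

lemma resSum_pendant {l t p k : ℕ} (hl : 3 ≤ l) (hlt : l ≤ t) (hp : p < t) :
    resSum l t p (t + k) p = resSum l t p t p + k := by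
  induction k with
  | zero => simp
  | succ k ih =>
    have : resSum l t p (t + k + 1) p = resSum l t p (t + k) p + pendantRes l t p p (t + k) :=
      Finset.sum_range_succ ..
    rw [← add_assoc, this, ih, pendantRes_comm, pendantRes_attach hl hp (by omega) (by omega),
      parent, if_neg (by omega), pendantRes_self]
    push_cast
    ring

/-- The Kirchhoff index of a cycle of length `l` with a tail of length `s` and `k` pendant
vertices attached to a vertex whose resistance distances to the cycle and tail sum to `A`. -/
def pendantKf (l s k A : ℝ) : ℝ := lollipopKf l s + k * (A + l + s) + k * (k - 1)

lemma kirchhoffIndex_eq_pendantKf {l s k p : ℕ} (hl : 3 ≤ l) (hp : p < l + s) :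
    kirchhoffIndex (PtLpend (l + s + k) l (l + s) p) = pendantKf l s k
      (tailSum l s (p - (l - 1) : ℕ) (cycleRes l (min p (l - 1)) (l - 1))) := by
  rw [kirchhoffIndex_PtLpend hl (by omega) hp (by omega)]
  induction k with
  | zero =>
    rw [add_zero, resTotal_tail hl hp le_rfl]
    simp [pendantKf]
  | succ k ih =>
    rw [← add_assoc, resTotal_succ hl hp (by omega), ih, parent, if_neg (by omega),
      resSum_pendant hl (by omega) hp, resSum_tail hl le_rfl hp]
    unfold pendantKf
    push_cast
    ring

/-! ### Degrees -/

/-- The number of neighbours of `x` below `n`. -/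
def linkDegree (l t p n x : ℕ) : ℕ := ∑ y ∈ Finset.range n, if Link l t p x y then 1 else 0

lemma degree'_PtLpend {l t p n : ℕ} (x : Fin n) :
    degree' (PtLpend n l t p) x = linkDegree l t p n x := by
  unfold degree' linkDegree
  rw [← Fin.sum_univ_eq_sum_range (fun y => if Link l t p x y then 1 else 0),
    ← Finset.card_filter, Nat.card_eq_fintype_card, Fintype.card_subtype]
  congr 1
  ext y
  simp [PtLpend_adj]

lemma linkDegree_succ {l t p n x : ℕ} (hl : 3 ≤ l) (hlt : l ≤ t) (hp : p < t) (hn : l ≤ n)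
    (hx : x < n) :
    linkDegree l t p (n + 1) x = linkDegree l t p n x + if x = parent t p n then 1 else 0 := by
  unfold linkDegree
  rw [Finset.sum_range_succ, if_congr (link_attach hl hlt hp hn hx) rfl rfl]

lemma linkDegree_self {l t p n : ℕ} (hl : 3 ≤ l) (hlt : l ≤ t) (hp : p < t) (hn : l ≤ n) :
    linkDegree l t p (n + 1) n = 1 := by
  have hpar := parent_lt hl hp hn
  unfold linkDegree
  have h : ∀ y ∈ Finset.range n, (if Link l t p n y then 1 else 0)
      = if y = parent t p n then 1 else 0 := fun y hy =>
    if_congr (link_comm.trans (link_attach hl hlt hp hn (Finset.mem_range.1 hy))) rfl rfl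
  rw [Finset.sum_range_succ, if_neg (fun h => h.1 rfl), add_zero, Finset.sum_congr rfl h]
  simp [hpar]

lemma linkDegree_cycle {l t p x : ℕ} (hl : 3 ≤ l) (hlt : l ≤ t) (hx : x < l) :
    linkDegree l t p l x = 2 := by
  unfold linkDegree
  rw [← Finset.card_filter, Finset.card_eq_two]
  refine ⟨if x = 0 then l - 1 else x - 1, if x = l - 1 then 0 else x + 1, ?_, ?_⟩
  · split_ifs <;> omega
  · ext y
    simp only [Finset.mem_filter, Finset.mem_range, Finset.mem_insert, Finset.mem_singleton]
    constructor
    · rintro ⟨hy, hL⟩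
      rw [link_cycle hl hlt hx hy] at hL
      split_ifs <;> omega
    · intro h
      have hy : y < l := by split_ifs at h <;> omega
      rw [link_cycle hl hlt hx hy]
      split_ifs at h <;> omega

lemma linkDegree_tail {l t p n x : ℕ} (hl : 3 ≤ l) (hp : p < t) (hn : l ≤ n) (hnt : n ≤ t)
    (hx : x < n) : linkDegree l t p n x
      = (if x < l then 2 else 1) + if l - 1 ≤ x ∧ x + 1 < n then 1 else 0 := by
  induction n, hn using Nat.le_induction generalizing x with
  | base =>
    rw [linkDegree_cycle hl hnt hx, if_pos hx, if_neg (by omega)]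
  | succ n hn ih =>
    rcases Nat.lt_succ_iff_lt_or_eq.1 hx with h | rfl
    · rw [linkDegree_succ hl (by omega) hp hn h, ih (by omega) h, parent,
        if_pos (by omega : n < t)]
      split_ifs <;> omega
    · rw [linkDegree_self hl (by omega) hp hn]
      split_ifs <;> omega

lemma linkDegree_pendant {l t p k : ℕ} (hl : 3 ≤ l) (hlt : l ≤ t) (hp : p < t) :
    linkDegree l t p (t + k) p
      = (if p < l then 2 else 1) + (if l - 1 ≤ p ∧ p + 1 < t then 1 else 0) + k := by
  induction k with
  | zero => rw [add_zero, add_zero, linkDegree_tail hl hp hlt le_rfl hp]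
  | succ k ih =>
    rw [← add_assoc, linkDegree_succ hl hlt hp (by omega) (by omega), ih, parent,
      if_neg (by omega : ¬ t + k < t), if_pos (rfl : p = p), add_assoc _ k 1]

/-! ### Comparison with `PnD3` -/

lemma PnD3_iso {n Δ : ℕ} (hΔ : 3 ≤ Δ) (hn : Δ < n) :
    Nonempty (PtLpend n 3 (n - Δ + 3) 2 ≃g PnD3 n Δ) := by
  refine ⟨⟨⟨fun j => ⟨if j.1 < 3 then j.1 else if j.1 < n - Δ + 3 then j.1 + Δ - 3
      else j.1 - (n - Δ), by have := j.2; split_ifs <;> omega⟩,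
    fun i => ⟨if i.1 < 3 then i.1 else if i.1 < Δ then i.1 + (n - Δ)
      else i.1 - Δ + 3, by have := i.2; split_ifs <;> omega⟩, ?_, ?_⟩, ?_⟩⟩
  · intro j
    have := j.2
    ext
    dsimp only
    split_ifs <;> omega
  · intro j
    have := j.2
    ext
    dsimp only
    split_ifs <;> omega
  · intro i j
    have := i.2
    have := j.2
    simp only [PtLpend_adj, PnD3, SimpleGraph.fromRel_adj, Equiv.coe_fn_mk, Fin.ext_iff, ne_eq,
      Link]
    split_ifs <;> omega

lemma PtLpend_triangle_iso {n p : ℕ} (hn : 4 ≤ n) (hp : p < 3) :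
    Nonempty (PtLpend n 3 3 p ≃g PtLpend n 3 4 2) := by
  refine ⟨⟨Equiv.swap ⟨p, by omega⟩ ⟨2, by omega⟩, ?_⟩⟩
  rintro ⟨i, hi⟩ ⟨j, hj⟩
  have hval : ∀ i (hi : i < n),
      ((Equiv.swap (⟨p, by omega⟩ : Fin n) ⟨2, by omega⟩ ⟨i, hi⟩ : Fin n) : ℕ)
        = if i = p then 2 else if i = 2 then p else i := by
    intro i hi
    simp only [Equiv.swap_apply_def, Fin.mk.injEq]
    split_ifs <;> rfl
  simp only [PtLpend_adj, hval, Link]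
  split_ifs <;> omega

lemma cycleRes_le {l : ℕ} (hl : 0 < l) {i : ℕ} (hi : i < l) :
    cycleRes l i (l - 1) ≤ l / 4 := by
  have hl0 : (0 : ℝ) < l := by exact_mod_cast hl
  rw [cycleRes_of_le (by omega)]
  set d : ℝ := ((l - 1 : ℕ) : ℝ) - i
  have : (l : ℝ) / 4 - (d - ((i : ℝ) - ((l - 1 : ℕ) : ℝ)) ^ 2 / l) = (l / 2 - d) ^ 2 / l := by
    field_simp
    ring
  have : 0 ≤ (l / 2 - d) ^ 2 / l := by positivity
  linarith

lemma PtLpend_lt_or_iso {l s k p Δ : ℕ} (hΔ : 3 ≤ Δ) (hl : 3 ≤ l) (hk : 1 ≤ k)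
    (hp : p < l + s)
    (hdeg : (if p < l then 2 else 1) + (if l - 1 ≤ p ∧ p + 1 < l + s then 1 else 0) + k = Δ) :
    kirchhoffIndex (PtLpend (l + s + k) l (l + s) p) < kirchhoffIndex (PnD3 (l + s + k) Δ) ∨
      Nonempty (PtLpend (l + s + k) l (l + s) p ≃g PnD3 (l + s + k) Δ) := by
  have hn : Δ < l + s + k := by split_ifs at hdeg <;> omega
  obtain ⟨φ⟩ := PnD3_iso hΔ hn
  obtain ⟨m, hm⟩ : ∃ m, l + s + k = Δ + m := ⟨l + s + k - Δ, by omega⟩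
  obtain ⟨j, rfl⟩ : ∃ j, Δ = j + 3 := ⟨Δ - 3, by omega⟩
  have hstar : kirchhoffIndex (PnD3 (l + s + k) (j + 3))
      = pendantKf 3 m j (tailSum 3 m 0 0) := by
    have h := kirchhoffIndex_eq_pendantKf (l := 3) (s := m) (k := j) (p := 2) le_rfl (by omega)
    rw [← kirchhoffIndex_eq_of_iso φ, show l + s + k - (j + 3) + 3 = 3 + m by omega,
      show l + s + k = 3 + m + j by omega, h]
    simp [cycleRes_self]
  obtain ⟨a, rfl⟩ : ∃ a, l = a + 3 := ⟨l - 3, by omega⟩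
  have htriangle : a = 0 → s = 0 →
      Nonempty (PtLpend (a + 3 + s + k) (a + 3) (a + 3 + s) p
        ≃g PnD3 (a + 3 + s + k) (j + 3)) := by
    rintro rfl rfl
    rw [if_pos (by omega), if_neg (by omega)] at hdeg
    obtain ⟨ψ⟩ := PtLpend_triangle_iso (n := 0 + 3 + 0 + k) (p := p) (by omega) (by omega)
    rw [show 0 + 3 + 0 + k - (j + 3) + 3 = 4 by omega] at φ
    exact ⟨ψ.trans φ⟩
  have hcycle : ∀ κ : ℝ, s = 0 → k = j + 1 → a ≠ 0 →
      pendantKf (a + 3 : ℕ) s k (tailSum (a + 3 : ℕ) s (0 : ℕ) κ)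
        < pendantKf 3 m j (tailSum 3 m 0 0) := by
    rintro κ rfl rfl ha
    obtain ⟨b, rfl⟩ := Nat.exists_eq_succ_of_ne_zero ha
    obtain rfl : m = b + 2 := by omega
    rw [← sub_pos]
    have : pendantKf 3 (b + 2 : ℕ) j (tailSum 3 (b + 2 : ℕ) 0 0)
        - pendantKf (b.succ + 3 : ℕ) (0 : ℕ) (j + 1 : ℕ)
          (tailSum (b.succ + 3 : ℕ) (0 : ℕ) (0 : ℕ) κ)
        = ((b + 1 : ℝ) * (24 + 6 * j + (b + 1) * (13 + 4 * j) + (b + 1) ^ 2)) / 12 := by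
      unfold pendantKf lollipopKf tailSum
      push_cast
      ring
    rw [this]
    positivity
  rw [hstar, kirchhoffIndex_eq_pendantKf hl hp]
  rcases Nat.lt_or_ge (a + 3) (p + 2) with hpl | hpl
  · rw [min_eq_right (by omega), cycleRes_self]
    obtain ⟨q, rfl⟩ : ∃ q, p = a + 2 + q := ⟨p - (a + 2), by omega⟩
    rw [show a + 2 + q - (a + 3 - 1) = q by omega]
    rcases q with _ | q
    · rw [if_pos (by omega)] at hdeg
      rcases s with _ | s
      · rw [if_neg (by omega)] at hdeg
        by_cases ha : a = 0
        · exact Or.inr (htriangle ha rfl)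
        · exact Or.inl (hcycle 0 rfl (by omega) ha)
      · rw [if_pos (by omega)] at hdeg
        obtain rfl : k = j := by omega
        by_cases ha : a = 0
        · subst ha
          rw [show 0 + 3 + (s + 1) + k - (k + 3) + 3 = 0 + 3 + (s + 1) by omega] at φ
          exact Or.inr ⟨φ⟩
        left
        obtain ⟨b, rfl⟩ := Nat.exists_eq_succ_of_ne_zero ha
        obtain ⟨e, rfl⟩ := Nat.exists_eq_add_of_le' hk
        obtain rfl : m = b + s + 2 := by omega
        rw [← sub_pos]
        have : pendantKf 3 (b + s + 2 : ℕ) (e + 1 : ℕ) (tailSum 3 (b + s + 2 : ℕ) 0 0)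
            - pendantKf (b.succ + 3 : ℕ) (s + 1 : ℕ) (e + 1 : ℕ)
              (tailSum (b.succ + 3 : ℕ) (s + 1 : ℕ) (0 : ℕ) 0)
            = ((b + 1 : ℝ) * (30 + 6 * e + 30 * s + 12 * s * e
              + (b + 1) * (17 + 4 * e + 4 * s) + (b + 1) ^ 2)) / 12 := by
          unfold pendantKf lollipopKf tailSum
          push_cast
          ring
        rw [this]
        positivity
    · left
      rw [if_neg (by omega)] at hdeg
      split_ifs at hdeg with hend
      · obtain ⟨c, rfl⟩ : ∃ c, s = q + c + 2 := ⟨s - (q + 2), by omega⟩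
        obtain rfl : k = j + 1 := by omega
        obtain rfl : m = a + q + c + 3 := by omega
        rw [← sub_pos]
        have : pendantKf 3 (a + q + c + 3 : ℕ) j (tailSum 3 (a + q + c + 3 : ℕ) 0 0)
            - pendantKf (a + 3 : ℕ) (q + c + 2 : ℕ) (j + 1 : ℕ)
              (tailSum (a + 3 : ℕ) (q + c + 2 : ℕ) (q + 1 : ℕ) 0)
            = (36 + 12 * j + 36 * c + 24 * c * j + 12 * q + 12 * q * c + 12 * q * c * j
              + 72 * a + 18 * a * j + 30 * a * c + 12 * a * c * j + 18 * a * q + 21 * a ^ 2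
              + 4 * a ^ 2 * j + 4 * a ^ 2 * c + 4 * a ^ 2 * q + (a : ℝ) ^ 3) / 12 := by
          unfold pendantKf lollipopKf tailSum
          push_cast
          ring
        rw [this]
        positivity
      · obtain rfl : s = q + 1 := by omega
        obtain rfl : k = j + 2 := by omega
        obtain rfl : m = a + q + 3 := by omega
        rw [← sub_pos]
        have : pendantKf 3 (a + q + 3 : ℕ) j (tailSum 3 (a + q + 3 : ℕ) 0 0)
            - pendantKf (a + 3 : ℕ) (q + 1 : ℕ) (j + 2 : ℕ)
              (tailSum (a + 3 : ℕ) (q + 1 : ℕ) (q + 1 : ℕ) 0)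
            = (36 + 12 * j + 12 * q + 72 * a + 18 * a * j + 18 * a * q + 21 * a ^ 2
              + 4 * a ^ 2 * j + 4 * a ^ 2 * q + (a : ℝ) ^ 3) / 12 := by
          unfold pendantKf lollipopKf tailSum
          push_cast
          ring
        rw [this]
        positivity
  · rw [if_pos (by omega), if_neg (by omega)] at hdeg
    obtain rfl : k = j + 1 := by omega
    have hκ : cycleRes (a + 3) (min p (a + 3 - 1)) (a + 3 - 1) ≤ ((a + 3 : ℕ) : ℝ) / 4 :=
      cycleRes_le (by omega) (by omega)
    rw [Nat.sub_eq_zero_of_le (by omega : p ≤ a + 3 - 1)]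
    generalize cycleRes (a + 3) (min p (a + 3 - 1)) (a + 3 - 1) = κ at hκ
    rcases s with _ | s
    · by_cases ha : a = 0
      · exact Or.inr (htriangle ha rfl)
      · exact Or.inl (hcycle κ rfl rfl ha)
    · left
      obtain rfl : m = a + s + 2 := by omega
      rw [← sub_pos]
      have : pendantKf 3 (a + s + 2 : ℕ) j (tailSum 3 (a + s + 2 : ℕ) 0 0)
          - pendantKf (a + 3 : ℕ) (s + 1 : ℕ) (j + 1 : ℕ)
            (tailSum (a + 3 : ℕ) (s + 1 : ℕ) (0 : ℕ) κ)
          = (15 + 3 * j + 15 * s + 3 * s * j + 51 * a + 15 * a * j + 27 * a * s + 9 * a * s * j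
            + 17 * a ^ 2 + 4 * a ^ 2 * j + 4 * a ^ 2 * s + (a : ℝ) ^ 3) / 12
            + (j + 1) * (s + 1) * (((a + 3 : ℕ) : ℝ) / 4 - κ) := by
        unfold pendantKf lollipopKf tailSum
        push_cast
        ring
      rw [this]
      have := sub_nonneg.2 hκ
      positivity

/-- Among the graphs of `𝒫_{n,Δ}^l` for `3 ≤ l ≤ n − Δ + 2`, the Kirchhoff index is
maximized exactly by `P_{n,Δ}^3`. -/
theorem statement9 [Fintype V] (G : SimpleGraph V) (n l Δ : ℕ)
    (hΔ : 3 ≤ Δ) (hl : 3 ≤ l) (hln : l ≤ n - Δ + 2)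
    (hcard : Fintype.card V = n)
    (hG : MemPset n l Δ G) :
    kirchhoffIndex G ≤ kirchhoffIndex (PnD3 n Δ)
    ∧ (kirchhoffIndex G = kirchhoffIndex (PnD3 n Δ) ↔ Nonempty (G ≃g PnD3 n Δ)) := by
  obtain ⟨t, p, hpn, hlt, htn, hpt, hdeg, -, ⟨φ⟩⟩ := hG
  obtain ⟨s, rfl⟩ := Nat.exists_eq_add_of_le hlt
  obtain ⟨k, rfl⟩ := Nat.exists_eq_add_of_le (by omega : l + s ≤ n)
  rw [degree'_PtLpend, linkDegree_pendant hl hlt hpt] at hdeg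
  rw [kirchhoffIndex_eq_of_iso φ]
  rcases PtLpend_lt_or_iso hΔ hl (by omega) hpt hdeg with h | ⟨⟨ψ⟩⟩
  · exact ⟨h.le, fun he => absurd he h.ne,
      fun ⟨χ⟩ => (kirchhoffIndex_eq_of_iso φ).symm.trans (kirchhoffIndex_eq_of_iso χ)⟩
  · have he := kirchhoffIndex_eq_of_iso ψ
    exact ⟨he.le, fun _ => ⟨φ.trans ψ⟩, fun _ => he⟩

end KfPaper
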